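/- arXiv:2007.03649 — 3 statements merged into one kernel-verified Lean document; each statement's English description precedes it below -/
import Mathlib

section
/- Let T be a linear operator on a complex Hilbert space H defined on a subspace D(T) ⊆ H. Then the essential numerical range W_e(T) is a closed and convex subset of ℂ. -/
open Filter Topology
open scoped InnerProductSpace

noncomputable section

variable {H : Type*} [NormedAddCommGroup H] [InnerProductSpace ℂ H] [CompleteSpace H]

/-- The essential numerical range of an operator `T` defined on a subspace `D(T) = D` of the
complex Hilbert space `H`: the set of `λ ∈ ℂ` for which there is a sequence `(x n)` in `D` of
unit vectors converging weakly to `0` with `⟨T xₙ, xₙ⟩ → λ`. -/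
def essNumRange (D : Submodule ℂ H) (T : D →ₗ[ℂ] H) : Set ℂ :=
  {l : ℂ | ∃ x : ℕ → D, (∀ n, ‖(x n : H)‖ = 1) ∧
    (∀ y : H, Tendsto (fun n => ⟪(x n : H), y⟫_ℂ) atTop (𝓝 0)) ∧
    Tendsto (fun n => ⟪(x n : H), T (x n)⟫_ℂ) atTop (𝓝 l)}

lemma exists_phase (u v : ℂ) : ∃ c : ℂ, ‖c‖ = 1 ∧ ∃ r : ℝ,
    c * u + (starRingEnd ℂ) c * v = (r : ℂ) := by
  have key : ∀ c : ℂ, (c * (u - (starRingEnd ℂ) v)).im = 0 → ∃ r : ℝ,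
      c * u + (starRingEnd ℂ) c * v = (r : ℂ) := by
    intro c hc
    refine ⟨(c * u + (starRingEnd ℂ) c * v).re, ?_⟩
    apply Complex.ext
    · simp
    · simp only [Complex.mul_im, Complex.sub_re, Complex.sub_im, Complex.conj_re, Complex.conj_im,
        Complex.add_im, Complex.ofReal_im] at hc ⊢
      linarith
  by_cases hd : u - (starRingEnd ℂ) v = 0
  · exact ⟨1, by simp, key 1 (by simp [hd])⟩
  · have hn : ‖u - (starRingEnd ℂ) v‖ ≠ 0 := norm_ne_zero_iff.mpr hd
    refine ⟨(starRingEnd ℂ) (u - (starRingEnd ℂ) v) / (‖u - (starRingEnd ℂ) v‖ : ℂ), ?_, key _ ?_⟩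
    · rw [norm_div, RCLike.norm_conj, Complex.norm_real, norm_norm, div_self hn]
    · rw [div_mul_eq_mul_div, mul_comm, Complex.mul_conj, ← Complex.ofReal_div, Complex.ofReal_im]

lemma toeplitz_hausdorff_two (D : Submodule ℂ H) (T : D →ₗ[ℂ] H) (x y : D)
    (hx : ‖(x : H)‖ = 1) (hy : ‖(y : H)‖ = 1) (hxy : ‖⟪(x : H), (y : H)⟫_ℂ‖ ≤ 1 / 2)
    (t : ℝ) (ht0 : 0 ≤ t) (ht1 : t ≤ 1) :
    ∃ a b : ℂ, ‖a‖ ≤ 2 ∧ ‖b‖ ≤ 2 ∧ ‖((a • x + b • y : D) : H)‖ = 1 ∧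
      ⟪((a • x + b • y : D) : H), T (a • x + b • y)⟫_ℂ =
        (t : ℂ) * ⟪(x : H), T x⟫_ℂ + (1 - (t : ℂ)) * ⟪(y : H), T y⟫_ℂ := by
  by_cases hpq : ⟪(x : H), T x⟫_ℂ = ⟪(y : H), T y⟫_ℂ
  · refine ⟨1, 0, by simp, by simp, by simpa using hx, ?_⟩
    simp only [one_smul, zero_smul, add_zero]
    rw [← hpq]; ring
  have hpq' : ⟪(x : H), T x⟫_ℂ - ⟪(y : H), T y⟫_ℂ ≠ 0 := sub_ne_zero.mpr hpq
  set p := ⟪(x : H), T x⟫_ℂ with hp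
  set q := ⟪(y : H), T y⟫_ℂ with hq
  set G := ⟪(x : H), (y : H)⟫_ℂ with hG
  have hG' : ⟪(y : H), (x : H)⟫_ℂ = (starRingEnd ℂ) G := (inner_conj_symm _ _).symm
  obtain ⟨c, hc, r, hr⟩ := exists_phase ((⟪(x : H), T y⟫_ℂ - q * G) / (p - q))
    ((⟪(y : H), T x⟫_ℂ - q * (starRingEnd ℂ) G) / (p - q))
  have hr' : c * (⟪(x : H), T y⟫_ℂ - q * G) +
      (starRingEnd ℂ) c * (⟪(y : H), T x⟫_ℂ - q * (starRingEnd ℂ) G) = (p - q) * r := by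
    rw [← hr]; field_simp
  have hcc : (starRingEnd ℂ) c * c = 1 := by
    rw [mul_comm, Complex.mul_conj, Complex.normSq_eq_norm_sq, hc]; simp
  set ρ : ℝ := (c * G).re with hρ
  have hρb : |ρ| ≤ 1 / 2 := by
    refine (Complex.abs_re_le_norm _).trans ?_
    rw [norm_mul, hc, one_mul]; exact hxy
  have hρ' : c * G + (starRingEnd ℂ) c * (starRingEnd ℂ) G = ((2 * ρ : ℝ) : ℂ) := by
    rw [← map_mul, Complex.add_conj]
  have hxx : ⟪(x : H), (x : H)⟫_ℂ = 1 := by rw [inner_self_eq_norm_sq_to_K, hx]; simp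
  have hyy : ⟪(y : H), (y : H)⟫_ℂ = 1 := by rw [inner_self_eq_norm_sq_to_K, hy]; simp
  let N : ℝ → ℝ := fun s => s ^ 2 + (1 - s) ^ 2 + 2 * s * (1 - s) * ρ
  let F : ℝ → ℝ := fun s => s ^ 2 + s * (1 - s) * r - t * N s
  obtain ⟨s, ⟨hs0, hs1⟩, hs⟩ : (0 : ℝ) ∈ F '' Set.Icc 0 1 := by
    refine intermediate_value_Icc zero_le_one (by fun_prop) ⟨?_, ?_⟩
    · simp [F, N, ht0]
    · simp [F, N, ht1]
  have hN4 : 1 / 4 ≤ N s := by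
    have h1 := (abs_le.mp hρb).1
    have h2 : 0 ≤ s * (1 - s) := mul_nonneg hs0 (by linarith)
    simp only [N]
    nlinarith [sq_nonneg (s - 1 / 2), mul_nonneg h2 (by linarith : 0 ≤ ρ + 1 / 2)]
  set m : ℝ := Real.sqrt (N s) with hm
  have hmm : m ^ 2 = N s := Real.sq_sqrt (by linarith)
  have hm2 : 1 / 2 ≤ m := by
    apply Real.le_sqrt_of_sq_le; linarith
  have hm0 : m ≠ 0 := by linarith
  have hmC : (m : ℂ) ≠ 0 := by exact_mod_cast hm0
  have hmmC : (m : ℂ) ^ 2 = (s : ℂ) ^ 2 + (1 - s) ^ 2 + s * (1 - s) * ((2 * ρ : ℝ) : ℂ) := by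
    rw [← Complex.ofReal_pow, hmm]; simp only [N]; push_cast; ring
  have hsC : (s : ℂ) ^ 2 + s * (1 - s) * r = t * (m : ℂ) ^ 2 := by
    have : s ^ 2 + s * (1 - s) * r = t * m ^ 2 := by
      rw [hmm]; simp only [F] at hs; linarith
    exact_mod_cast this
  have hconj : ∀ a : ℝ, (starRingEnd ℂ) (a : ℂ) = a := Complex.conj_ofReal
  refine ⟨(s / m : ℝ), ((1 - s) / m : ℝ) * c, ?_, ?_, ?_, ?_⟩
  · rw [Complex.norm_real, Real.norm_eq_abs, abs_of_nonneg (by positivity), div_le_iff₀ (by linarith)]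
    linarith
  · rw [norm_mul, hc, Complex.norm_real, Real.norm_eq_abs,
      abs_of_nonneg (div_nonneg (by linarith) (by linarith)), mul_one, div_le_iff₀ (by linarith)]
    linarith
  · have h : ∀ v : H, ⟪v, v⟫_ℂ = 1 → ‖v‖ = 1 := by
      intro v hv
      have : ‖v‖ ^ 2 = 1 := by
        rw [← inner_self_eq_norm_sq (𝕜 := ℂ), hv]; simp
      nlinarith [norm_nonneg v]
    apply h
    simp only [Submodule.coe_add, Submodule.coe_smul, inner_add_left, inner_add_right,
      inner_smul_left, inner_smul_right, map_mul, hconj, hxx, hyy, hG', ← hG]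
    push_cast
    field_simp
    rw [hmmC, ← hρ']
    linear_combination (1 - (s : ℂ)) ^ 2 * hcc
  · simp only [Submodule.coe_add, Submodule.coe_smul, inner_add_left, inner_add_right, map_add,
      map_smul,
      inner_smul_left, inner_smul_right, map_mul, hconj, ← hp, ← hq]
    push_cast
    field_simp
    linear_combination (1 - (s : ℂ)) ^ 2 * q * hcc + s * (1 - s) * hr' + (p - q) * hsC
      + s * (1 - s) * q * hρ' - q * hmmC

/-- A bounded sequence lying in the span of vectors against which it tends to zero is
weakly null. -/
lemma weakly_null_of_family {ι : Type*} (e : ι → H) (z : ℕ → H) (hz : ∀ n, ‖z n‖ = 1)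
    (hze : ∀ n, ∃ i, z n = e i)
    (he : ∀ i, Tendsto (fun n => ⟪z n, e i⟫_ℂ) atTop (𝓝 0)) (v : H) :
    Tendsto (fun n => ⟪z n, v⟫_ℂ) atTop (𝓝 0) := by
  let N : Submodule ℂ H :=
    { carrier := {v | Tendsto (fun n => ⟪z n, v⟫_ℂ) atTop (𝓝 0)}
      add_mem' := by
        intro a b ha hb
        simpa [inner_add_right] using Tendsto.add ha hb
      zero_mem' := by simp
      smul_mem' := by
        intro c a ha
        simpa [inner_smul_right] using Tendsto.const_mul c ha }
  have hNmem : ∀ v, v ∈ N ↔ Tendsto (fun n => ⟪z n, v⟫_ℂ) atTop (𝓝 0) := fun v => Iff.rfl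
  have hclosed : IsClosed (N : Set H) := by
    apply isClosed_of_closure_subset
    intro w hw
    rw [SetLike.mem_coe, hNmem, Metric.tendsto_atTop]
    intro ε hε
    obtain ⟨u, hu, huw⟩ := Metric.mem_closure_iff.mp hw (ε / 2) (by linarith)
    obtain ⟨n0, hn0⟩ := Metric.tendsto_atTop.mp ((hNmem u).mp hu) (ε / 2) (by linarith)
    refine ⟨n0, fun n hn => ?_⟩
    have h1 := hn0 n hn
    rw [dist_zero_right] at h1 ⊢
    have h2 : ⟪z n, w⟫_ℂ = ⟪z n, u⟫_ℂ + ⟪z n, w - u⟫_ℂ := by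
      rw [← inner_add_right]; simp
    have h3 : ‖⟪z n, w - u⟫_ℂ‖ ≤ ‖w - u‖ := by
      have h4 := norm_inner_le_norm (𝕜 := ℂ) (z n) (w - u)
      rwa [hz n, one_mul] at h4
    rw [dist_eq_norm] at huw
    rw [h2]
    linarith [norm_add_le (⟪z n, u⟫_ℂ) (⟪z n, w - u⟫_ℂ)]
  have : CompleteSpace N := hclosed.completeSpace_coe
  have htop : N = ⊤ := by
    rw [← Submodule.orthogonal_eq_bot_iff, Submodule.eq_bot_iff]
    intro w hw
    have hwz : ∀ n, ⟪z n, w⟫_ℂ = 0 := by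
      intro n
      obtain ⟨i, hi⟩ := hze n
      rw [hi]
      exact (Submodule.mem_orthogonal N w).mp hw (e i) (he i)
    have hwN : w ∈ N := by
      rw [hNmem]; simp [hwz]
    exact inner_self_eq_zero.mp ((Submodule.mem_orthogonal N w).mp hw w hwN)
  have : v ∈ N := by rw [htop]; trivial
  exact this

lemma essNumRange_closed_aux (D : Submodule ℂ H) (T : D →ₗ[ℂ] H) :
    IsClosed (essNumRange D T) := by
  apply isClosed_of_closure_subset
  intro l hl
  obtain ⟨lk, hlk, hlim⟩ := mem_closure_iff_seq_limit.mp hl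
  choose x hx1 hx2 hx3 using hlk
  have hch : ∀ k : ℕ, ∃ n, (∀ i ∈ Finset.range (k + 1), ∀ j ∈ Finset.range (k + 1),
      ‖⟪(x k n : H), (x i j : H)⟫_ℂ‖ < 1 / ((k : ℝ) + 1)) ∧
      dist ⟪(x k n : H), T (x k n)⟫_ℂ (lk k) < 1 / ((k : ℝ) + 1) := by
    intro k
    have hk : 0 < 1 / ((k : ℝ) + 1) := by positivity
    have h1 : ∀ᶠ n in atTop, ∀ i ∈ Finset.range (k + 1), ∀ j ∈ Finset.range (k + 1),
        ‖⟪(x k n : H), (x i j : H)⟫_ℂ‖ < 1 / ((k : ℝ) + 1) := by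
      rw [Filter.eventually_all_finset]
      intro i _
      rw [Filter.eventually_all_finset]
      intro j _
      have := (hx2 k (x i j)).norm
      rw [norm_zero] at this
      exact this.eventually_lt_const hk
    exact (h1.and (Metric.tendsto_nhds.mp (hx3 k) _ hk)).exists
  choose n hn1 hn2 using hch
  refine ⟨fun k => x k (n k), fun k => hx1 _ _, ?_, ?_⟩
  · apply weakly_null_of_family (fun ij : ℕ × ℕ => (x ij.1 ij.2 : H))
    · exact fun k => hx1 _ _
    · exact fun k => ⟨(k, n k), rfl⟩
    · rintro ⟨i, j⟩
      refine squeeze_zero_norm' ?_ tendsto_one_div_add_atTop_nhds_zero_nat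
      filter_upwards [eventually_ge_atTop (max i j)] with k hk
      have := max_le_iff.mp hk
      exact (hn1 k i (by simp; omega) j (by simp; omega)).le
  · have h0 : Tendsto (fun k => dist (lk k) ⟪(x k (n k) : H), T (x k (n k))⟫_ℂ) atTop (𝓝 0) := by
      refine squeeze_zero (fun _ => dist_nonneg) (fun k => ?_)
        tendsto_one_div_add_atTop_nhds_zero_nat
      rw [dist_comm]
      exact (hn2 k).le
    exact (tendsto_iff_of_dist h0).mp hlim

lemma essNumRange_convex_aux (D : Submodule ℂ H) (T : D →ₗ[ℂ] H) :
    Convex ℝ (essNumRange D T) := by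
  rintro l ⟨x, hx1, hx2, hx3⟩ l' ⟨y, hy1, hy2, hy3⟩ a b ha hb hab
  have hch : ∀ n : ℕ, ∃ m, n ≤ m ∧ ‖⟪(x n : H), (y m : H)⟫_ℂ‖ ≤ 1 / 2 := by
    intro n
    have h := (hy2 (x n)).norm
    rw [norm_zero] at h
    have h2 := h.eventually_lt_const (show (0 : ℝ) < 1 / 2 by norm_num)
    obtain ⟨m, hm, hm2⟩ := ((eventually_ge_atTop n).and h2).exists
    refine ⟨m, hm, ?_⟩
    rw [norm_inner_symm]
    exact hm2.le
  choose m hm1 hm2 using hch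
  have hmt : Tendsto m atTop atTop := tendsto_atTop_mono hm1 tendsto_id
  have hz := fun n => toeplitz_hausdorff_two D T (x n) (y (m n)) (hx1 n) (hy1 _) (hm2 n) a ha
    (by linarith)
  choose α β hα hβ hz1 hz2 using hz
  refine ⟨fun n => α n • x n + β n • y (m n), hz1, ?_, ?_⟩
  · intro v
    have h1 : Tendsto (fun n => 2 * ‖⟪(x n : H), v⟫_ℂ‖ + 2 * ‖⟪(y (m n) : H), v⟫_ℂ‖) atTop
        (𝓝 0) := by
      have := ((hx2 v).norm.const_mul 2).add (((hy2 v).comp hmt).norm.const_mul 2)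
      simpa using this
    refine squeeze_zero_norm (fun n => ?_) h1
    simp only [Submodule.coe_add, Submodule.coe_smul, inner_add_left, inner_smul_left]
    refine (norm_add_le _ _).trans ?_
    rw [norm_mul, norm_mul, RCLike.norm_conj, RCLike.norm_conj]
    gcongr
    · exact hα n
    · exact hβ n
  · simp only [hz2]
    have hb' : (1 - (a : ℂ)) = b := by
      rw [← Complex.ofReal_one, ← hab]; push_cast; ring
    rw [hb']
    simp only [Complex.real_smul]
    exact (hx3.const_mul _).add ((hy3.comp hmt).const_mul _)

/-- the essential numerical range is a closed, convex subset of `ℂ`. -/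
theorem essNumRange_isClosed_and_convex (D : Submodule ℂ H) (T : D →ₗ[ℂ] H) :
    IsClosed (essNumRange D T) ∧ Convex ℝ (essNumRange D T) := by
  exact ⟨essNumRange_closed_aux D T, essNumRange_convex_aux D T⟩
end
end

section
/- Let 𝔞 be a sesquilinear form on a complex Hilbert space H whose domain D(𝔞) is dense in H, which is symmetric (𝔞[x,y] = conj(𝔞[y,x]) for all x, y ∈ D(𝔞)), bounded below (there exists γ ∈ ℝ with 𝔞[x] ≥ γ‖x‖² for all x ∈ D(𝔞)), and closed (whenever x_n ∈ D(𝔞), x_n → x in the norm of H, and 𝔞[x_n − x_m] → 0 as n, m → ∞, then x ∈ D(𝔞) and 𝔞[x_n − x] → 0). Let x, y ∈ D(𝔞) and let (x_n) be a sequence in D(𝔞) converging weakly to x such that the sequence (𝔞[x_n]) is bounded. Then 𝔞[x_n, y] → 𝔞[x, y]. -/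
open Filter Topology
open scoped InnerProductSpace

noncomputable section

variable {H : Type*} [NormedAddCommGroup H] [InnerProductSpace ℂ H] [CompleteSpace H]

/-- Weak convergence lifts along an injective bounded map, for bounded sequences. -/
lemma weak_lift {V K : Type*} [NormedAddCommGroup V] [InnerProductSpace ℂ V] [CompleteSpace V]
    [NormedAddCommGroup K] [InnerProductSpace ℂ K] [CompleteSpace K]
    (j : V →L[ℂ] K) (hj : Function.Injective j) (u : ℕ → V) (x : V) (M : ℝ)
    (hM : ∀ n, ‖u n‖ ≤ M)
    (hw : ∀ v : K, Tendsto (fun n => ⟪v, j (u n)⟫_ℂ) atTop (𝓝 ⟪v, j x⟫_ℂ)) (y : V) :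
    Tendsto (fun n => ⟪y, u n⟫_ℂ) atTop (𝓝 ⟪y, x⟫_ℂ) := by
  have hd : DenseRange (ContinuousLinearMap.adjoint j) := by
    have h1 : (LinearMap.range (ContinuousLinearMap.adjoint j).toLinearMap).topologicalClosure = ⊤ := by
      rw [Submodule.topologicalClosure_eq_top_iff, Submodule.eq_bot_iff]
      intro z hz
      apply hj
      rw [map_zero, ← inner_self_eq_zero (𝕜 := ℂ), ← ContinuousLinearMap.adjoint_inner_left]
      exact (Submodule.mem_orthogonal _ _).1 hz _ ⟨j z, rfl⟩
    have h2 := Submodule.dense_iff_topologicalClosure_eq_top.2 h1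
    exact h2
  have hM0 : 0 ≤ M := (norm_nonneg _).trans (hM 0)
  rw [Metric.tendsto_atTop]
  intro ε hε
  have hC : 0 < M + ‖x‖ + 1 := by positivity
  obtain ⟨v, hv⟩ := hd.exists_dist_lt y (show 0 < ε / 2 / (M + ‖x‖ + 1) by positivity)
  rw [dist_eq_norm, lt_div_iff₀ hC] at hv
  obtain ⟨N, hN⟩ := (Metric.tendsto_atTop.1 (hw v)) (ε / 2) (by positivity)
  refine ⟨N, fun n hn => ?_⟩
  have h3 := hN n hn
  rw [dist_eq_norm, ← inner_sub_right, ← map_sub, ← ContinuousLinearMap.adjoint_inner_left] at h3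
  rw [dist_eq_norm, ← inner_sub_right]
  have h4 : ⟪y, u n - x⟫_ℂ = ⟪y - ContinuousLinearMap.adjoint j v, u n - x⟫_ℂ
      + ⟪ContinuousLinearMap.adjoint j v, u n - x⟫_ℂ := by
    rw [← inner_add_left, sub_add_cancel]
  have h5 : ‖⟪y - ContinuousLinearMap.adjoint j v, u n - x⟫_ℂ‖ ≤
      ‖y - ContinuousLinearMap.adjoint j v‖ * (M + ‖x‖ + 1) := by
    refine (norm_inner_le_norm _ _).trans ?_
    gcongr
    have := norm_sub_le (u n) x
    have := hM n
    linarith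
  rw [h4]
  refine (norm_add_le _ _).trans_lt ?_
  linarith

/-- Core version. -/
lemma weak_lift_core {V K : Type*} [AddCommGroup V] [Module ℂ V] (c : InnerProductSpace.Core ℂ V)
    [NormedAddCommGroup K] [InnerProductSpace ℂ K] [CompleteSpace K]
    (j : V →ₗ[ℂ] K) (hj : Function.Injective j)
    (hle : ∀ x, ‖j x‖ ^ 2 ≤ (c.inner x x).re)
    (hcomp : ∀ u : ℕ → V,
      Tendsto (fun p : ℕ × ℕ => (c.inner (u p.1 - u p.2) (u p.1 - u p.2)).re) atTop (𝓝 0) →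
      ∃ x, Tendsto (fun n => (c.inner (u n - x) (u n - x)).re) atTop (𝓝 0))
    (u : ℕ → V) (x : V) (M : ℝ)
    (hM : ∀ n, (c.inner (u n) (u n)).re ≤ M)
    (hw : ∀ v : K, Tendsto (fun n => ⟪v, j (u n)⟫_ℂ) atTop (𝓝 ⟪v, j x⟫_ℂ)) (y : V) :
    Tendsto (fun n => c.inner y (u n)) atTop (𝓝 (c.inner y x)) := by
  letI : NormedAddCommGroup V := c.toNormedAddCommGroup
  letI : InnerProductSpace ℂ V := InnerProductSpace.ofCore c.toCore
  have hn : ∀ z : V, (c.inner z z).re = ‖z‖ ^ 2 := fun z => (norm_sq_eq_re_inner (𝕜 := ℂ) z).symm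
  haveI : CompleteSpace V := by
    apply Metric.complete_of_cauchySeq_tendsto
    intro w hw
    obtain ⟨z, hz⟩ := hcomp w (by
      simp only [hn]
      have h := (cauchySeq_iff_tendsto_dist_atTop_0.1 hw).pow 2
      simpa [dist_eq_norm] using h)
    refine ⟨z, ?_⟩
    simp only [hn] at hz
    rw [tendsto_iff_norm_sub_tendsto_zero]
    have := hz.sqrt
    simpa using this
  have hj1 : ∀ z, ‖j z‖ ≤ 1 * ‖z‖ := fun z => by
    have := hle z
    rw [hn] at this
    rw [one_mul]
    exact le_of_sq_le_sq this (norm_nonneg _)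
  exact weak_lift (j.mkContinuous 1 hj1) hj u x (Real.sqrt M)
    (fun n => Real.le_sqrt_of_sq_le (by rw [← hn]; exact hM n)) hw y

/-- Let `𝔞` be a densely defined, symmetric, bounded-below, closed sesquilinear
form on `H` with domain `D`. If `x, y ∈ D`, `(uₙ)` is a sequence in `D` converging weakly to
`x`, and `(𝔞[uₙ])` is bounded, then `𝔞[uₙ, y] → 𝔞[x, y]`. -/
theorem form_weak_continuity (D : Submodule ℂ H) (𝔞 : D →ₗ[ℂ] D →ₗ⋆[ℂ] ℂ)
    (hdense : Dense (D : Set H))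
    (hsymm : ∀ x y : D, 𝔞 x y = (starRingEnd ℂ) (𝔞 y x))
    (hbelow : ∃ γ : ℝ, ∀ x : D, γ * ‖(x : H)‖ ^ 2 ≤ (𝔞 x x).re)
    (hclosed : ∀ (u : ℕ → D) (x : H),
      Tendsto (fun n => ((u n : H))) atTop (𝓝 x) →
      Tendsto (fun p : ℕ × ℕ => 𝔞 (u p.1 - u p.2) (u p.1 - u p.2)) atTop (𝓝 0) →
      ∃ hx : x ∈ D,
        Tendsto (fun n => 𝔞 (u n - ⟨x, hx⟩) (u n - ⟨x, hx⟩)) atTop (𝓝 0))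
    (x y : D) (u : ℕ → D)
    (hweak : ∀ v : H, Tendsto (fun n => ⟪(u n : H), v⟫_ℂ) atTop (𝓝 ⟪(x : H), v⟫_ℂ))
    (hbdd : ∃ M : ℝ, ∀ n, ‖𝔞 (u n) (u n)‖ ≤ M) :
    Tendsto (fun n => 𝔞 (u n) y) atTop (𝓝 (𝔞 x y)) := by
  obtain ⟨γ, hγ⟩ := hbelow
  obtain ⟨M, hM⟩ := hbdd
  have hw' : ∀ v : H, Tendsto (fun n => ⟪v, (u n : H)⟫_ℂ) atTop (𝓝 ⟪v, (x : H)⟫_ℂ) := by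
    intro v
    have := (Complex.continuous_conj.tendsto _).comp (hweak v)
    simpa [Function.comp_def] using this
  obtain ⟨C, hC⟩ : ∃ C, ∀ n, ‖(u n : H)‖ ≤ C := by
    obtain ⟨C, hC⟩ := banach_steinhaus (g := fun n => innerSL ℂ (u n : H)) (fun v => by
      obtain ⟨C, hC⟩ := (hweak v).norm.bddAbove_range
      exact ⟨C, fun n => hC ⟨n, rfl⟩⟩)
    exact ⟨C, fun n => by simpa using hC n⟩
  have hre : ∀ z : D, ((𝔞 z z).re : ℂ) = 𝔞 z z := fun z =>
    Complex.conj_eq_iff_re.1 (hsymm z z).symm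
  set k : ℝ := 1 + |γ| with hk
  have hk0 : 0 ≤ k := by positivity
  have hself : ∀ z : D, (𝔞 z z + (k : ℂ) * ⟪(z : H), (z : H)⟫_ℂ).re
      = (𝔞 z z).re + k * ‖(z : H)‖ ^ 2 := fun z => by
    rw [inner_self_eq_norm_sq_to_K, Complex.add_re, Complex.re_ofReal_mul]
    norm_cast
  have hge : ∀ z : D, ‖(z : H)‖ ^ 2 ≤ (𝔞 z z).re + k * ‖(z : H)‖ ^ 2 := fun z => by
    have h1 := hγ z
    have h2 : 0 ≤ (γ + |γ|) * ‖(z : H)‖ ^ 2 :=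
      mul_nonneg (by linarith [neg_abs_le γ]) (by positivity)
    rw [hk]
    linarith
  let c : InnerProductSpace.Core ℂ D :=
    { inner := fun a b => 𝔞 b a + (k : ℂ) * ⟪(a : H), (b : H)⟫_ℂ
      conj_inner_symm := fun a b => by
        simp only [map_add, map_mul, Complex.conj_ofReal, inner_conj_symm]
        rw [← hsymm]
      re_inner_nonneg := fun a => by
        change 0 ≤ (𝔞 a a + (k : ℂ) * ⟪(a : H), (a : H)⟫_ℂ).re
        rw [hself]
        exact (sq_nonneg _).trans (hge a)
      add_left := fun a b d => by
        simp only [map_add, Submodule.coe_add, inner_add_left]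
        ring
      smul_left := fun a b r => by
        simp only [LinearMap.map_smulₛₗ, Submodule.coe_smul, inner_smul_left, smul_eq_mul]
        ring
      definite := fun a ha => by
        have h1 := hge a
        rw [← hself, ha] at h1
        have h2 : ‖(a : H)‖ ^ 2 = 0 := le_antisymm (by simpa using h1) (by positivity)
        simpa using h2 }
  have hcself : ∀ z : D, (c.inner z z).re = (𝔞 z z).re + k * ‖(z : H)‖ ^ 2 := hself
  have key := weak_lift_core c D.subtype D.injective_subtype
    (fun z => by rw [hcself]; exact hge z) (fun w hw => by
      simp only [hcself] at hw
      have h1 : Tendsto (fun p : ℕ × ℕ => ‖((w p.1 - w p.2 : D) : H)‖ ^ 2) atTop (𝓝 0) :=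
        squeeze_zero (fun _ => by positivity) (fun p => hge _) hw
      have h2 : CauchySeq (fun n => (w n : H)) := by
        rw [cauchySeq_iff_tendsto_dist_atTop_0]
        simpa [dist_eq_norm] using h1.sqrt
      obtain ⟨z, hz⟩ := cauchySeq_tendsto_of_complete h2
      obtain ⟨hzD, h3⟩ := hclosed w z hz (by
        have h4 : Tendsto (fun p : ℕ × ℕ => (𝔞 (w p.1 - w p.2) (w p.1 - w p.2)).re)
            atTop (𝓝 0) := by
          have := hw.sub (h1.const_mul k)
          simpa using this
        have h5 := (Complex.continuous_ofReal.tendsto _).comp h4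
        simpa only [Function.comp_def, hre, Complex.ofReal_zero] using h5)
      refine ⟨⟨z, hzD⟩, ?_⟩
      simp only [hcself]
      have h6 := (Complex.continuous_re.tendsto _).comp h3
      have h7 := ((tendsto_iff_norm_sub_tendsto_zero.1 hz).pow 2).const_mul k
      have h8 := h6.add h7
      simpa [Function.comp_def] using h8)
    u x (M + k * C ^ 2) (fun n => by
      rw [hcself]
      have h1 := (Complex.re_le_norm _).trans (hM n)
      have h2 := hC n
      gcongr) hw' y
  have h1 := key.sub ((hw' (y : H)).const_mul (k : ℂ))
  have h2 : ∀ z : D, c.inner y z - (k : ℂ) * ⟪(y : H), (z : H)⟫_ℂ = 𝔞 z y := fun z =>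
    add_sub_cancel_right _ _
  simpa only [h2] using h1
end
end

section
/- Let H be an infinite-dimensional complex Hilbert space, let (A_k)_{k≥0} be bounded self-adjoint operators on H with Σ_k ‖A_k‖ r^k < ∞ for some r > 0, and for real t with |t| < r set A(t) = Σ_{k≥0} t^k A_k (each A(t) is a bounded self-adjoint operator). Let Σ(t) denote the minimum of σ_e(A(t)) and assume Σ(0) = 0. Let T = A₀ + iA₁. Then the set {s ∈ ℝ : is ∈ W_e(T)} is nonempty and has a minimum ω, and Σ(t)/t → ω as t → 0⁺. -/
open Filter Topology
open scoped InnerProductSpace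

noncomputable section

variable {H : Type*} [NormedAddCommGroup H] [InnerProductSpace ℂ H] [CompleteSpace H]

/-- The essential numerical range of a bounded operator `S` on `H`. -/
def essNumRangeB (S : H →L[ℂ] H) : Set ℂ :=
  {l : ℂ | ∃ x : ℕ → H, (∀ n, ‖x n‖ = 1) ∧
    (∀ y : H, Tendsto (fun n => ⟪x n, y⟫_ℂ) atTop (𝓝 0)) ∧
    Tendsto (fun n => ⟪x n, S (x n)⟫_ℂ) atTop (𝓝 l)}

/-- The essential spectrum of a bounded operator `S` on `H`. -/
def essSpecB (S : H →L[ℂ] H) : Set ℂ :=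
  {l : ℂ | ∃ x : ℕ → H, (∀ n, ‖x n‖ = 1) ∧
    (∀ y : H, Tendsto (fun n => ⟪x n, y⟫_ℂ) atTop (𝓝 0)) ∧
    Tendsto (fun n => ‖S (x n) - l • x n‖) atTop (𝓝 0)}

/-- The operator `A(t) = Σ_k t^k A_k`. -/
def seriesOp (A : ℕ → H →L[ℂ] H) (t : ℝ) : H →L[ℂ] H :=
  ∑' k : ℕ, ((t : ℂ)) ^ k • A k

lemma ess_closed_submodule (x : ℕ → H) (hx : ∀ n, ‖x n‖ = 1)
    (hm : ∀ m, Tendsto (fun n => ⟪x n, x m⟫_ℂ) atTop (𝓝 0)) :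
    ∀ y : H, Tendsto (fun n => ⟪x n, y⟫_ℂ) atTop (𝓝 0) := by
  let G : Submodule ℂ H :=
    { carrier := {y | Tendsto (fun n => ⟪x n, y⟫_ℂ) atTop (𝓝 0)}
      add_mem' := by
        intro a b ha hb
        simp only [Set.mem_setOf_eq, inner_add_right] at *
        simpa using ha.add hb
      zero_mem' := by simp
      smul_mem' := by
        intro c a ha
        simp only [Set.mem_setOf_eq, inner_smul_right] at *
        simpa using ha.const_mul c }
  have hG : ∀ y, y ∈ G ↔ Tendsto (fun n => ⟪x n, y⟫_ℂ) atTop (𝓝 0) := fun y => Iff.rfl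
  have hcl : IsClosed (G : Set H) := by
    rw [← closure_subset_iff_isClosed]
    intro y hy
    rw [SetLike.mem_coe, hG, Metric.tendsto_atTop]
    intro ε hε
    obtain ⟨g, hg, hgy⟩ := Metric.mem_closure_iff.1 hy (ε / 2) (by positivity)
    obtain ⟨N, hN⟩ := Metric.tendsto_atTop.1 ((hG g).1 hg) (ε / 2) (by positivity)
    refine ⟨N, fun n hn => ?_⟩
    have h1 := hN n hn
    rw [dist_zero_right] at *
    have h2 : ⟪x n, y⟫_ℂ = ⟪x n, y - g⟫_ℂ + ⟪x n, g⟫_ℂ := by rw [← inner_add_right]; simp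
    have h3 : ‖⟪x n, y - g⟫_ℂ‖ ≤ ‖y - g‖ := by
      exact (norm_inner_le_norm (𝕜 := ℂ) (x n) (y - g)).trans (by rw [hx n, one_mul])
    rw [dist_eq_norm] at hgy
    rw [h2]
    exact (norm_add_le _ _).trans_lt (by linarith)
  have : CompleteSpace G := hcl.completeSpace_coe
  have htop : G = ⊤ := by
    rw [← Submodule.orthogonal_eq_bot_iff, eq_bot_iff]
    intro y hy
    have hyG : y ∈ G := by
      rw [hG]
      have : ∀ n, ⟪x n, y⟫_ℂ = 0 := fun n => (Submodule.mem_orthogonal G y).1 hy (x n) ((hG _).2 (hm n))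
      simp [this]
    have := (Submodule.mem_orthogonal G y).1 hy y hyG
    simpa using this
  intro y
  rw [← hG, htop]
  trivial

lemma ess_of_approx (S : H →L[ℂ] H) (l : ℂ)
    (h : ∀ s : Finset H, ∀ ε : ℝ, 0 < ε →
      ∃ x : H, ‖x‖ = 1 ∧ (∀ y ∈ s, ‖⟪x, y⟫_ℂ‖ < ε) ∧ ‖⟪x, S x⟫_ℂ - l‖ < ε) :
    l ∈ essNumRangeB S := by
  classical
  obtain ⟨f, hf, hr⟩ := exists_seq_of_forall_finset_exists
    (fun p : ℕ × H => ‖p.2‖ = 1 ∧ ‖⟪p.2, S p.2⟫_ℂ - l‖ < 1 / ((p.1 : ℝ) + 1))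
    (fun p q => p.1 < q.1 ∧ ‖⟪q.2, p.2⟫_ℂ‖ < 1 / ((q.1 : ℝ) + 1)) (by
      intro s _
      let N := s.sup Prod.fst + 1
      obtain ⟨x, hx1, hx2, hx3⟩ := h (s.image Prod.snd) (1 / ((N : ℝ) + 1)) (by positivity)
      refine ⟨(N, x), ⟨hx1, hx3⟩, fun p hp => ⟨?_, hx2 _ (Finset.mem_image_of_mem _ hp)⟩⟩
      exact Nat.lt_succ_of_le (Finset.le_sup (f := Prod.fst) hp))
  have hmono : StrictMono (fun n => (f n).1) := fun m n hmn => (hr m n hmn).1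
  have hlim : Tendsto (fun n => 1 / (((f n).1 : ℝ) + 1)) atTop (𝓝 0) :=
    tendsto_one_div_add_atTop_nhds_zero_nat.comp hmono.tendsto_atTop
  refine ⟨fun n => (f n).2, fun n => (hf n).1, ?_, ?_⟩
  · refine ess_closed_submodule _ (fun n => (hf n).1) fun m => ?_
    refine squeeze_zero_norm' ?_ hlim
    filter_upwards [eventually_gt_atTop m] with n hn
    exact (hr m n hn).2.le
  · rw [tendsto_iff_norm_sub_tendsto_zero]
    exact squeeze_zero (fun _ => norm_nonneg _) (fun n => (hf n).2.le) hlim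

lemma ess_approx (S : H →L[ℂ] H) (l : ℂ) (hl : l ∈ essNumRangeB S)
    (s : Finset H) (ε : ℝ) (hε : 0 < ε) :
    ∃ x : H, ‖x‖ = 1 ∧ (∀ y ∈ s, ‖⟪x, y⟫_ℂ‖ < ε) ∧ ‖⟪x, S x⟫_ℂ - l‖ < ε := by
  obtain ⟨x, hx, hw, hS⟩ := hl
  have h1 : ∀ᶠ n in atTop, ∀ y ∈ s, ‖⟪x n, y⟫_ℂ‖ < ε := by
    rw [Filter.eventually_all_finset]
    intro y _
    have := (hw y).norm
    rw [norm_zero] at this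
    exact this.eventually_lt_const hε
  have h2 : ∀ᶠ n in atTop, ‖⟪x n, S (x n)⟫_ℂ - l‖ < ε :=
    (tendsto_iff_norm_sub_tendsto_zero.1 hS).eventually_lt_const hε
  obtain ⟨n, hn1, hn2⟩ := (h1.and h2).exists
  exact ⟨x n, hx n, hn1, hn2⟩

lemma ess_inner_bound (S : H →L[ℂ] H) (x : H) (hx : ‖x‖ = 1) : ‖⟪x, S x⟫_ℂ‖ ≤ ‖S‖ := by
  have h1 := norm_inner_le_norm (𝕜 := ℂ) x (S x)
  have h2 := S.le_opNorm x
  rw [hx] at h1 h2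
  linarith

lemma ess_isCompact (S : H →L[ℂ] H) : IsCompact (essNumRangeB S) := by
  refine Metric.isCompact_of_isClosed_isBounded ?_ ?_
  · rw [← closure_subset_iff_isClosed]
    intro l hl
    refine ess_of_approx S l fun s ε hε => ?_
    obtain ⟨m, hm, hml⟩ := Metric.mem_closure_iff.1 hl (ε / 2) (by positivity)
    obtain ⟨x, h1, h2, h3⟩ := ess_approx S m hm s (ε / 2) (by positivity)
    refine ⟨x, h1, fun y hy => (h2 y hy).trans (by linarith), ?_⟩
    rw [dist_comm, dist_eq_norm] at hml
    have : ⟪x, S x⟫_ℂ - l = (⟪x, S x⟫_ℂ - m) + (m - l) := by ring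
    rw [this]
    exact (norm_add_le _ _).trans_lt (by linarith)
  · refine (Metric.isBounded_closedBall (x := (0 : ℂ)) (r := ‖S‖)).subset ?_
    rintro l ⟨x, hx, -, hS⟩
    rw [mem_closedBall_zero_iff]
    exact le_of_tendsto hS.norm (Eventually.of_forall fun n => ess_inner_bound S _ (hx n))

lemma ess_subseq (S : H →L[ℂ] H) (x : ℕ → H) (hx : ∀ n, ‖x n‖ = 1)
    (hw : ∀ y : H, Tendsto (fun n => ⟪x n, y⟫_ℂ) atTop (𝓝 0)) :
    ∃ l ∈ essNumRangeB S, ∃ φ : ℕ → ℕ, StrictMono φ ∧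
      Tendsto (fun n => ⟪x (φ n), S (x (φ n))⟫_ℂ) atTop (𝓝 l) := by
  obtain ⟨l, -, φ, hφ, hl⟩ := tendsto_subseq_of_bounded
    (Metric.isBounded_closedBall (x := (0 : ℂ)) (r := ‖S‖))
    (x := fun n => ⟪x n, S (x n)⟫_ℂ)
    (fun n => mem_closedBall_zero_iff.2 (ess_inner_bound S _ (hx n)))
  exact ⟨l, ⟨fun n => x (φ n), fun n => hx _, fun y => (hw y).comp hφ.tendsto_atTop, hl⟩, φ, hφ, hl⟩

lemma ess_nonempty (hinf : ¬ FiniteDimensional ℂ H) (S : H →L[ℂ] H) :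
    (essNumRangeB S).Nonempty := by
  have h0 : (0 : ℂ) ∈ essNumRangeB (0 : H →L[ℂ] H) := by
    refine ess_of_approx _ _ fun s ε hε => ?_
    have hne : Submodule.span ℂ (s : Set H) ≠ ⊤ := by
      intro h
      exact hinf (Module.finite_def.2 ⟨s, h⟩)
    have : FiniteDimensional ℂ (Submodule.span ℂ (s : Set H)) :=
      FiniteDimensional.span_finset ℂ s
    have h2 : (Submodule.span ℂ (s : Set H))ᗮ ≠ ⊥ := by
      rwa [Ne, Submodule.orthogonal_eq_bot_iff]
    obtain ⟨v, hv, hv0⟩ := Submodule.exists_mem_ne_zero_of_ne_bot h2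
    refine ⟨((‖v‖⁻¹ : ℝ) : ℂ) • v, ?_, fun y hy => ?_, ?_⟩
    · rw [norm_smul]
      simp [hv0]
    · have := (Submodule.mem_orthogonal' _ v).1 hv y (Submodule.subset_span hy)
      rw [inner_smul_left, this]
      simpa using hε
    · simpa using hε
  obtain ⟨x, hx, hw, -⟩ := h0
  obtain ⟨l, hl, -⟩ := ess_subseq S x hx hw
  exact ⟨l, hl⟩

lemma ess_inner_real (B : H →L[ℂ] H) (hB : IsSelfAdjoint B) (x : H) :
    (⟪x, B x⟫_ℂ).im = 0 := by
  have h1 : ⟪B x, x⟫_ℂ = ⟪x, B x⟫_ℂ := hB.isSymmetric x x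
  rw [← inner_conj_symm] at h1
  exact Complex.conj_eq_iff_im.1 h1

/-- a lower bound on the essential numerical range gives asymptotic lower bounds of the form -/
lemma ess_lower (B : H →L[ℂ] H) (m : ℝ) (hm : ∀ l ∈ essNumRangeB B, m ≤ l.re)
    (z : ℕ → H) (C : ℝ) (hzC : ∀ n, ‖z n‖ ≤ C)
    (hw : ∀ y : H, Tendsto (fun n => ⟪z n, y⟫_ℂ) atTop (𝓝 0)) (ε : ℝ) (hε : 0 < ε) :
    ∀ᶠ n in atTop, -ε < (⟪z n, B (z n)⟫_ℂ).re - m * ‖z n‖ ^ 2 := by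
  by_contra hcon
  rw [not_eventually] at hcon
  obtain ⟨φ, hφ, hφ'⟩ := Filter.extraction_of_frequently_atTop hcon
  simp only [not_lt] at hφ'
  set D : ℝ := ‖B‖ + |m| + 1 with hD
  have hDpos : 0 < D := by positivity
  have hlow : ∀ n, ε ≤ D * ‖z (φ n)‖ ^ 2 := by
    intro n
    have h1 := hφ' n
    have h2 := norm_inner_le_norm (𝕜 := ℂ) (z (φ n)) (B (z (φ n)))
    have h3 := B.le_opNorm (z (φ n))
    have h4 := Complex.abs_re_le_norm ⟪z (φ n), B (z (φ n))⟫_ℂ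
    have h5 : ‖⟪z (φ n), B (z (φ n))⟫_ℂ‖ ≤ ‖B‖ * ‖z (φ n)‖ ^ 2 := by
      have := mul_le_mul_of_nonneg_left h3 (norm_nonneg (z (φ n)))
      nlinarith
    have h6 := neg_abs_le (⟪z (φ n), B (z (φ n))⟫_ℂ).re
    have h7 := mul_le_mul_of_nonneg_right (le_abs_self m) (sq_nonneg ‖z (φ n)‖)
    have h8 := sq_nonneg ‖z (φ n)‖
    rw [hD]
    nlinarith
  have hC0 : 0 ≤ C := (norm_nonneg _).trans (hzC 0)
  have hpos : ∀ n, 0 < ‖z (φ n)‖ := by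
    intro n
    rcases (norm_nonneg (z (φ n))).eq_or_lt with h | h
    · have := hlow n
      rw [← h] at this
      simp at this
      linarith
    · exact h
  let u : ℕ → H := fun n => ((‖z (φ n)‖⁻¹ : ℝ) : ℂ) • z (φ n)
  have hu : ∀ n, ‖u n‖ = 1 := by
    intro n
    simp only [u, norm_smul, Complex.norm_real, norm_inv, norm_norm]
    exact inv_mul_cancel₀ (hpos n).ne'
  have hK : 0 < ε / D := by positivity
  have huw : ∀ y : H, Tendsto (fun n => ⟪u n, y⟫_ℂ) atTop (𝓝 0) := by
    intro y
    have h1 : Tendsto (fun n => (Real.sqrt (ε / D))⁻¹ * ‖⟪z (φ n), y⟫_ℂ‖) atTop (𝓝 0) := by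
      have := (((hw y).comp hφ.tendsto_atTop).norm).const_mul (Real.sqrt (ε / D))⁻¹
      simpa using this
    refine squeeze_zero_norm (fun n => ?_) h1
    simp only [u, inner_smul_left, norm_mul, Complex.conj_ofReal, Complex.norm_real, norm_inv,
      norm_norm]
    refine mul_le_mul_of_nonneg_right ?_ (norm_nonneg _)
    refine inv_anti₀ (Real.sqrt_pos.2 hK) ?_
    refine Real.sqrt_le_iff.2 ⟨(hpos n).le, ?_⟩
    rw [div_le_iff₀ hDpos]
    have := hlow n
    linarith
  obtain ⟨l, hl, ψ, hψ, hlim⟩ := ess_subseq B u hu huw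
  have h1 := hm l hl
  have hre : Tendsto (fun n => (⟪u (ψ n), B (u (ψ n))⟫_ℂ).re) atTop (𝓝 l.re) :=
    (Complex.continuous_re.tendsto l).comp hlim
  have h2 : l.re ≤ m - ε / (C ^ 2 + 1) := by
    refine le_of_tendsto hre (Eventually.of_forall fun n => ?_)
    have h3 := hφ' (ψ n)
    have hp := hpos (ψ n)
    have hc := hzC (φ (ψ n))
    have e : ⟪u (ψ n), B (u (ψ n))⟫_ℂ
        = (((‖z (φ (ψ n))‖ ^ 2)⁻¹ : ℝ) : ℂ) * ⟪z (φ (ψ n)), B (z (φ (ψ n)))⟫_ℂ := by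
      simp only [u, map_smul, inner_smul_left, inner_smul_right, Complex.conj_ofReal]
      push_cast
      ring
    simp only [e, Complex.re_ofReal_mul]
    set a := ‖z (φ (ψ n))‖
    have h4 : (a ^ 2)⁻¹ * (⟪z (φ (ψ n)), B (z (φ (ψ n)))⟫_ℂ).re ≤ (a ^ 2)⁻¹ * (m * a ^ 2 - ε) :=
      mul_le_mul_of_nonneg_left (by linarith) (by positivity)
    have h5 : (a ^ 2)⁻¹ * (m * a ^ 2 - ε) = m - ε / a ^ 2 := by field_simp
    have h6 : ε / (C ^ 2 + 1) ≤ ε / a ^ 2 := by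
      apply div_le_div_of_nonneg_left hε.le (by positivity)
      nlinarith
    linarith
  have : 0 < ε / (C ^ 2 + 1) := by positivity
  linarith

lemma essSpec_subset (S : H →L[ℂ] H) : essSpecB S ⊆ essNumRangeB S := by
  rintro l ⟨x, hx, hw, hS⟩
  refine ⟨x, hx, hw, ?_⟩
  rw [tendsto_iff_norm_sub_tendsto_zero]
  refine squeeze_zero (fun _ => norm_nonneg _) (fun n => ?_) hS
  have h1 : ⟪x n, S (x n)⟫_ℂ - l = ⟪x n, S (x n) - l • x n⟫_ℂ := by
    rw [inner_sub_right, inner_smul_right, inner_self_eq_norm_sq_to_K, hx n]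
    simp
  rw [h1]
  exact (norm_inner_le_norm (𝕜 := ℂ) (x n) (S (x n) - l • x n)).trans (by rw [hx n, one_mul])

lemma essNum_im (B : H →L[ℂ] H) (hB : IsSelfAdjoint B) (l : ℂ) (hl : l ∈ essNumRangeB B) :
    l.im = 0 := by
  obtain ⟨x, hx, hw, hS⟩ := hl
  have h : Tendsto (fun n => (⟪x n, B (x n)⟫_ℂ).im) atTop (𝓝 l.im) :=
    (Complex.continuous_im.tendsto l).comp hS
  simp only [ess_inner_real B hB] at h
  exact (tendsto_nhds_unique h tendsto_const_nhds)

lemma ess_min_mem (B : H →L[ℂ] H) (hB : IsSelfAdjoint B) (m : ℝ)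
    (hmem : (m : ℂ) ∈ essNumRangeB B) (hm : ∀ l ∈ essNumRangeB B, m ≤ l.re) :
    (m : ℂ) ∈ essSpecB B := by
  obtain ⟨x, hx, hw, hS⟩ := hmem
  refine ⟨x, hx, hw, ?_⟩
  let E : H →L[ℂ] H := B - (m : ℂ) • ContinuousLinearMap.id ℂ H
  have hE : ∀ v, E v = B v - (m : ℂ) • v := fun v => by simp [E]
  have hEs : ∀ v w, ⟪E v, w⟫_ℂ = ⟪v, E w⟫_ℂ := by
    intro v w
    have h1 : ⟪B v, w⟫_ℂ = ⟪v, B w⟫_ℂ := hB.isSymmetric v w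
    simp only [hE, inner_sub_left, inner_sub_right, inner_smul_left, inner_smul_right, h1,
      Complex.conj_ofReal]
  have hq : ∀ v, (⟪v, E v⟫_ℂ).re = (⟪v, B v⟫_ℂ).re - m * ‖v‖ ^ 2 := by
    intro v
    rw [hE, inner_sub_right, inner_smul_right, inner_self_eq_norm_sq_to_K]
    simp [← Complex.ofReal_pow]
  let y : ℕ → H := fun n => E (x n)
  have hyw : ∀ v : H, Tendsto (fun n => ⟪y n, v⟫_ℂ) atTop (𝓝 0) := by
    intro v
    simp only [y, hEs]
    exact hw _
  have hyb : ∀ n, ‖y n‖ ≤ ‖E‖ := fun n => by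
    have := E.le_opNorm (x n)
    rwa [hx n, mul_one] at this
  have hqx : Tendsto (fun n => (⟪x n, E (x n)⟫_ℂ).re) atTop (𝓝 0) := by
    simp only [hq, hx]
    have h : Tendsto (fun n => (⟪x n, B (x n)⟫_ℂ).re) atTop (𝓝 m) :=
      (Complex.continuous_re.tendsto (m : ℂ)).comp hS
    simpa using h.sub_const m
  have hqy : ∀ n, (⟪y n, E (y n)⟫_ℂ).re ≤ ‖E‖ ^ 3 := by
    intro n
    have h1 := Complex.re_le_norm ⟪y n, E (y n)⟫_ℂ
    have h2 := norm_inner_le_norm (𝕜 := ℂ) (y n) (E (y n))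
    have h3 := E.le_opNorm (y n)
    have h4 := hyb n
    have h5 : ‖E (y n)‖ ≤ ‖E‖ * ‖E‖ := h3.trans (mul_le_mul_of_nonneg_left h4 (norm_nonneg _))
    have h6 : ‖y n‖ * ‖E (y n)‖ ≤ ‖E‖ * (‖E‖ * ‖E‖) :=
      mul_le_mul h4 h5 (norm_nonneg _) (norm_nonneg _)
    calc _ ≤ _ := h1.trans (h2.trans h6)
      _ = _ := by ring
  have hexp : ∀ (δ : ℝ) n, (⟪x n - (δ : ℂ) • y n, E (x n - (δ : ℂ) • y n)⟫_ℂ).re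
      = (⟪x n, E (x n)⟫_ℂ).re - 2 * δ * ‖y n‖ ^ 2 + δ ^ 2 * (⟪y n, E (y n)⟫_ℂ).re := by
    intro δ n
    have h1 : ⟪x n, E (y n)⟫_ℂ = ((‖y n‖ ^ 2 : ℝ) : ℂ) := by
      rw [← hEs]
      change ⟪y n, y n⟫_ℂ = _
      rw [inner_self_eq_norm_sq_to_K]
      simp
    have h2 : ⟪y n, E (x n)⟫_ℂ = ((‖y n‖ ^ 2 : ℝ) : ℂ) := by
      change ⟪y n, y n⟫_ℂ = _
      rw [inner_self_eq_norm_sq_to_K]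
      simp
    simp only [map_sub, map_smul, inner_sub_left, inner_sub_right, inner_smul_left,
      inner_smul_right, Complex.conj_ofReal, h1, h2, Complex.sub_re, Complex.re_ofReal_mul,
      Complex.ofReal_re]
    ring
  have hsq : Tendsto (fun n => ‖y n‖ ^ 2) atTop (𝓝 0) := by
    rw [Metric.tendsto_atTop']
    intro ε hε
    set K : ℝ := ‖E‖ ^ 3 + 1 with hK
    have hKpos : 0 < K := by positivity
    set δ : ℝ := ε / K with hδ
    have hδpos : 0 < δ := by positivity
    have hδK : δ * K = ε := by rw [hδ]; field_simp
    have hlow := ess_lower B m hm (fun n => x n - (δ : ℂ) • y n) (1 + δ * ‖E‖) (by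
        intro n
        refine (norm_sub_le _ _).trans ?_
        rw [hx n, norm_smul, Complex.norm_real, Real.norm_of_nonneg hδpos.le]
        have := mul_le_mul_of_nonneg_left (hyb n) hδpos.le
        linarith) (by
        intro v
        simp only [inner_sub_left, inner_smul_left, Complex.conj_ofReal]
        simpa using (hw v).sub ((hyw v).const_mul (δ : ℂ))) (δ * ε / 4) (by positivity)
    have hqx' : ∀ᶠ n in atTop, (⟪x n, E (x n)⟫_ℂ).re < δ * ε / 4 :=
      hqx.eventually_lt_const (by positivity)
    obtain ⟨N, hN⟩ := eventually_atTop.1 (hlow.and hqx')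
    refine ⟨N, fun n hn => ?_⟩
    obtain ⟨h1, h2⟩ := hN n hn.le
    rw [← hq, hexp] at h1
    have h3 := hqy n
    rw [dist_zero_right, Real.norm_of_nonneg (by positivity)]
    have h4 : δ ^ 2 * (⟪y n, E (y n)⟫_ℂ).re ≤ δ * ε := by
      have : δ ^ 2 * (⟪y n, E (y n)⟫_ℂ).re ≤ δ ^ 2 * K :=
        mul_le_mul_of_nonneg_left (by linarith) (by positivity)
      calc _ ≤ _ := this
        _ = δ * (δ * K) := by ring
        _ = _ := by rw [hδK]
    have h5 : δ * (2 * ‖y n‖ ^ 2) < δ * (3 / 2 * ε) := by nlinarith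
    have h6 := lt_of_mul_lt_mul_left h5 hδpos.le
    linarith
  have hfin : Tendsto (fun n => ‖y n‖) atTop (𝓝 0) := by
    have := hsq.sqrt
    simpa using this
  simpa only [y, hE] using hfin

/-- the minimum of the essential spectrum. -/
lemma ess_sInf (hinf : ¬ FiniteDimensional ℂ H) (B : H →L[ℂ] H) (hB : IsSelfAdjoint B) :
    ((sInf {s : ℝ | (s : ℂ) ∈ essSpecB B} : ℝ) : ℂ) ∈ essNumRangeB B ∧
      ∀ l ∈ essNumRangeB B, sInf {s : ℝ | (s : ℂ) ∈ essSpecB B} ≤ l.re := by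
  obtain ⟨l, hl, hmin⟩ := (ess_isCompact B).exists_isMinOn (ess_nonempty hinf B)
    Complex.continuous_re.continuousOn
  have hlr : ((l.re : ℝ) : ℂ) = l := by
    apply Complex.ext <;> simp [essNum_im B hB l hl]
  have hleast : IsLeast {s : ℝ | (s : ℂ) ∈ essSpecB B} l.re := by
    refine ⟨ess_min_mem B hB l.re (by rwa [hlr]) (fun k hk => hmin hk), fun s hs => ?_⟩
    have := hmin (essSpec_subset B hs)
    simpa using this
  rw [hleast.csInf_eq, hlr]
  exact ⟨hl, fun k hk => hmin hk⟩

lemma slope_abstract (W : Set ℂ) (hW : IsCompact W) (hre : ∀ z ∈ W, 0 ≤ z.re)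
    (z0 : ℂ) (hz0 : z0 ∈ W) (hz0re : z0.re = 0) (f : ℝ → ℝ) (C r : ℝ) (hr : 0 < r)
    (hC : 0 ≤ C)
    (hup : ∀ t, 0 < t → t < r → ∀ z ∈ W, f t ≤ z.re + t * z.im + C * t ^ 2)
    (hlo : ∀ t, 0 < t → t < r → ∃ z ∈ W, z.re + t * z.im - C * t ^ 2 ≤ f t) :
    ∃ ω : ℝ, IsLeast {s : ℝ | Complex.I * (s : ℂ) ∈ W} ω ∧
      Tendsto (fun t : ℝ => f t / t) (𝓝[>] (0 : ℝ)) (𝓝 ω) := by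
  have hIs : ∀ z : ℂ, z.re = 0 → Complex.I * ((z.im : ℝ) : ℂ) = z := by
    intro z hz
    apply Complex.ext <;> simp [hz]
  have hcl : IsClosed {z : ℂ | z.re = 0} := isClosed_eq Complex.continuous_re continuous_const
  obtain ⟨w, ⟨hwW, hw0⟩, hwmin⟩ := (hW.inter_right hcl).exists_isMinOn ⟨z0, hz0, hz0re⟩
    Complex.continuous_im.continuousOn
  simp only [Set.mem_setOf_eq] at hw0
  refine ⟨w.im, ⟨by simpa [hIs w hw0] using hwW, fun s hs => ?_⟩, ?_⟩
  · have := hwmin (show Complex.I * (s : ℂ) ∈ W ∩ {z : ℂ | z.re = 0} from ⟨hs, by simp⟩)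
    simpa using this
  obtain ⟨M, hM⟩ := hW.isBounded.exists_norm_le
  have hM0 : 0 ≤ M := (norm_nonneg _).trans (hM w hwW)
  rw [Metric.tendsto_nhdsWithin_nhds]
  intro ε hε
  have hc : ∃ c : ℝ, 0 < c ∧ ∀ z ∈ W, z.im ≤ w.im - ε / 2 → c ≤ z.re := by
    have hcl2 : IsClosed {z : ℂ | z.im ≤ w.im - ε / 2} :=
      isClosed_le Complex.continuous_im continuous_const
    rcases (W ∩ {z : ℂ | z.im ≤ w.im - ε / 2}).eq_empty_or_nonempty with h | h
    · refine ⟨1, one_pos, fun z hz hz' => ?_⟩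
      have : z ∈ W ∩ {z : ℂ | z.im ≤ w.im - ε / 2} := ⟨hz, hz'⟩
      rw [h] at this
      exact this.elim
    · obtain ⟨v, ⟨hvW, hv⟩, hvmin⟩ := (hW.inter_right hcl2).exists_isMinOn h
        Complex.continuous_re.continuousOn
      simp only [Set.mem_setOf_eq] at hv
      refine ⟨v.re, lt_of_le_of_ne (hre v hvW) (fun h0 => ?_), fun z hz hz' => hvmin ⟨hz, hz'⟩⟩
      have := hwmin (show v ∈ W ∩ {z : ℂ | z.re = 0} from ⟨hvW, h0.symm⟩)
      simp only [Set.mem_setOf_eq] at this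
      linarith
  obtain ⟨c, hc0, hc⟩ := hc
  set d : ℝ := min (min r 1) (min (ε / (4 * (C + 1))) (c / (2 * M + 2 * C + 1))) with hd
  refine ⟨d, by positivity, fun {t} ht htd => ?_⟩
  have ht0 : 0 < t := ht
  rw [dist_zero_right, Real.norm_of_nonneg ht0.le] at htd
  have htr : t < r := htd.trans_le ((min_le_left _ _).trans (min_le_left _ _))
  have ht1 : t < 1 := htd.trans_le ((min_le_left _ _).trans (min_le_right _ _))
  have htε : t < ε / (4 * (C + 1)) := htd.trans_le ((min_le_right _ _).trans (min_le_left _ _))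
  have htc : t < c / (2 * M + 2 * C + 1) :=
    htd.trans_le ((min_le_right _ _).trans (min_le_right _ _))
  rw [lt_div_iff₀ (by positivity)] at htε htc
  have hu := hup t ht0 htr w hwW
  obtain ⟨z, hzW, hz⟩ := hlo t ht0 htr
  have hzim : w.im - ε / 2 < z.im := by
    by_contra hcon
    push Not at hcon
    have h1 := hc z hzW hcon
    have h2 := (Complex.abs_im_le_norm z).trans (hM z hzW)
    have h3 := (Complex.abs_im_le_norm w).trans (hM w hwW)
    have h4 := (abs_le.1 h2).1
    have h5 := (abs_le.1 h3).2
    have h6 := mul_le_mul_of_nonneg_left h4 ht0.le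
    have h7 := mul_le_mul_of_nonneg_left h5 ht0.le
    have h8 : C * t ^ 2 ≤ C * t := mul_le_mul_of_nonneg_left (by nlinarith) hC
    nlinarith
  have hz0' := hre z hzW
  have hsq : C * t < ε / 2 := by nlinarith
  rw [Real.dist_eq, abs_lt]
  constructor
  · rw [lt_sub_iff_add_lt, lt_div_iff₀ ht0]
    nlinarith [mul_lt_mul_of_pos_left hzim ht0, mul_lt_mul_of_pos_left hsq ht0]
  · rw [sub_lt_iff_lt_add, div_lt_iff₀ ht0]
    nlinarith [mul_lt_mul_of_pos_left hsq ht0]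

lemma series_rem (A : ℕ → H →L[ℂ] H) (r : ℝ) (hr : 0 < r)
    (hsum : Summable (fun k => ‖A k‖ * r ^ k)) (t : ℝ) (ht : |t| < r) :
    ‖seriesOp A t - (A 0 + (t : ℂ) • A 1)‖ ≤ ((∑' k, ‖A k‖ * r ^ k) / r ^ 2) * t ^ 2 := by
  have hb : ∀ k, ‖((t : ℂ)) ^ k • A k‖ ≤ ‖A k‖ * r ^ k := by
    intro k
    rw [norm_smul, norm_pow, Complex.norm_real, Real.norm_eq_abs, mul_comm]
    gcongr
  have hs : Summable (fun k => ((t : ℂ)) ^ k • A k) := Summable.of_norm_bounded hsum hb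
  have e : seriesOp A t - (A 0 + (t : ℂ) • A 1) = ∑' k, ((t : ℂ)) ^ (k + 2) • A (k + 2) := by
    unfold seriesOp
    rw [← hs.sum_add_tsum_nat_add 2]
    simp [Finset.sum_range_succ]
  rw [e]
  have hsum2 : Summable (fun k => ‖A (k + 2)‖ * r ^ (k + 2)) := (summable_nat_add_iff 2).2 hsum
  have hb2 : ∀ k, ‖((t : ℂ)) ^ (k + 2) • A (k + 2)‖ ≤ (t ^ 2 / r ^ 2) * (‖A (k + 2)‖ * r ^ (k + 2)) := by
    intro k
    rw [norm_smul, norm_pow, Complex.norm_real, Real.norm_eq_abs, pow_add, pow_add, sq_abs]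
    have : t ^ 2 / r ^ 2 * (‖A (k + 2)‖ * (r ^ k * r ^ 2)) = r ^ k * t ^ 2 * ‖A (k + 2)‖ := by
      field_simp
    rw [this]
    gcongr
  refine (tsum_of_norm_bounded (hsum2.hasSum.mul_left _) hb2).trans ?_
  have h1 : ∑' k, ‖A (k + 2)‖ * r ^ (k + 2) ≤ ∑' k, ‖A k‖ * r ^ k := by
    rw [← hsum.sum_add_tsum_nat_add 2]
    have : 0 ≤ ∑ i ∈ Finset.range 2, ‖A i‖ * r ^ i := Finset.sum_nonneg fun i _ => by positivity
    linarith
  calc _ ≤ t ^ 2 / r ^ 2 * ∑' k, ‖A k‖ * r ^ k := mul_le_mul_of_nonneg_left h1 (by positivity)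
    _ = _ := by ring

lemma series_sa (A : ℕ → H →L[ℂ] H) (hsa : ∀ k, IsSelfAdjoint (A k)) (t : ℝ) :
    IsSelfAdjoint (seriesOp A t) := by
  unfold seriesOp
  rw [IsSelfAdjoint, tsum_star]
  congr 1
  ext1 k
  rw [star_smul, (hsa k).star_eq]
  simp

/-- for a holomorphic family `A(t) = Σ t^k A_k` of bounded self-adjoint operators
with `Σ(t) = min σ_e(A(t))` and `Σ(0) = 0`, setting `T = A₀ + i A₁`, the set
`{s : ℝ | i s ∈ W_e(T)}` has a least element `ω` and `Σ(t)/t → ω` as `t → 0⁺`. -/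
theorem min_essSpec_slope (hinf : ¬ FiniteDimensional ℂ H)
    (A : ℕ → H →L[ℂ] H) (hsa : ∀ k, IsSelfAdjoint (A k))
    (r : ℝ) (hr : 0 < r) (hsum : Summable (fun k => ‖A k‖ * r ^ k))
    (Sg : ℝ → ℝ)
    (hSg : ∀ t : ℝ, |t| < r → Sg t = sInf {s : ℝ | (s : ℂ) ∈ essSpecB (seriesOp A t)})
    (hSg0 : Sg 0 = 0) :
    ∃ ω : ℝ,
      IsLeast {s : ℝ | Complex.I * (s : ℂ) ∈ essNumRangeB (A 0 + Complex.I • A 1)} ω ∧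
      Tendsto (fun t : ℝ => Sg t / t) (𝓝[>] (0 : ℝ)) (𝓝 ω) := by
  set T := A 0 + Complex.I • A 1 with hT
  set C : ℝ := (∑' k, ‖A k‖ * r ^ k) / r ^ 2 with hCdef
  have hC : 0 ≤ C := by
    have : 0 ≤ ∑' k, ‖A k‖ * r ^ k := tsum_nonneg fun k => by positivity
    positivity
  have hTx : ∀ x, (⟪x, T x⟫_ℂ).re = (⟪x, A 0 x⟫_ℂ).re ∧ (⟪x, T x⟫_ℂ).im = (⟪x, A 1 x⟫_ℂ).re := by
    intro x
    have h0 := ess_inner_real (A 0) (hsa 0) x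
    have h1 := ess_inner_real (A 1) (hsa 1) x
    simp only [hT, ContinuousLinearMap.add_apply, ContinuousLinearMap.smul_apply,
      inner_add_right, inner_smul_right, Complex.add_re, Complex.add_im, Complex.mul_re,
      Complex.mul_im, Complex.I_re, Complex.I_im, h0, h1]
    constructor <;> ring
  have hrem : ∀ t : ℝ, |t| < r → ∀ x : H, ‖x‖ = 1 →
      |(⟪x, seriesOp A t x⟫_ℂ).re - ((⟪x, T x⟫_ℂ).re + t * (⟪x, T x⟫_ℂ).im)| ≤ C * t ^ 2 := by
    intro t ht x hx
    have h1 := series_rem A r hr hsum t ht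
    have h2 := ess_inner_bound (seriesOp A t - (A 0 + (t : ℂ) • A 1)) x hx
    have h3 := Complex.abs_re_le_norm ⟪x, (seriesOp A t - (A 0 + (t : ℂ) • A 1)) x⟫_ℂ
    have h4 : (⟪x, (seriesOp A t - (A 0 + (t : ℂ) • A 1)) x⟫_ℂ).re =
        (⟪x, seriesOp A t x⟫_ℂ).re - ((⟪x, T x⟫_ℂ).re + t * (⟪x, T x⟫_ℂ).im) := by
      rw [(hTx x).1, (hTx x).2]
      simp only [ContinuousLinearMap.sub_apply, ContinuousLinearMap.add_apply,
        ContinuousLinearMap.smul_apply, inner_add_right, inner_sub_right, inner_smul_right,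
        Complex.add_re, Complex.sub_re, Complex.re_ofReal_mul]
    rw [← h4]
    exact h3.trans (h2.trans h1)
  have hup : ∀ t : ℝ, |t| < r → ∀ z ∈ essNumRangeB T, Sg t ≤ z.re + t * z.im + C * t ^ 2 := by
    rintro t ht z ⟨x, hx, hw, hz⟩
    obtain ⟨l, hl, φ, hφ, hlim⟩ := ess_subseq (seriesOp A t) x hx hw
    have h1 := (ess_sInf hinf _ (series_sa A hsa t)).2 l hl
    rw [← hSg t ht] at h1
    refine h1.trans ?_
    have hz' := hz.comp hφ.tendsto_atTop
    have hzr := (Complex.continuous_re.tendsto z).comp hz'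
    have hzi := (Complex.continuous_im.tendsto z).comp hz'
    refine le_of_tendsto_of_tendsto' ((Complex.continuous_re.tendsto l).comp hlim)
      ((hzr.add (hzi.const_mul t)).add_const (C * t ^ 2)) fun n => ?_
    have := (abs_le.1 (hrem t ht (x (φ n)) (hx _))).2
    simp only [Function.comp]
    linarith
  have hlo : ∀ t : ℝ, |t| < r → ∃ z ∈ essNumRangeB T, z.re + t * z.im - C * t ^ 2 ≤ Sg t := by
    intro t ht
    obtain ⟨x, hx, hw, hlim⟩ := (ess_sInf hinf _ (series_sa A hsa t)).1
    rw [← hSg t ht] at hlim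
    obtain ⟨z, hz, φ, hφ, hz'⟩ := ess_subseq T x hx hw
    refine ⟨z, hz, ?_⟩
    have hzr := (Complex.continuous_re.tendsto z).comp hz'
    have hzi := (Complex.continuous_im.tendsto z).comp hz'
    have hl := (Complex.continuous_re.tendsto _).comp (hlim.comp hφ.tendsto_atTop)
    rw [Complex.ofReal_re] at hl
    refine le_of_tendsto_of_tendsto' ((hzr.add (hzi.const_mul t)).sub_const (C * t ^ 2)) hl
      fun n => ?_
    have := (abs_le.1 (hrem t ht (x (φ n)) (hx _))).1
    simp only [Function.comp]
    linarith
  have hre : ∀ z ∈ essNumRangeB T, 0 ≤ z.re := by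
    intro z hz
    have := hup 0 (by simpa using hr) z hz
    rw [hSg0] at this
    simpa using this
  obtain ⟨z0, hz0, hz0'⟩ := hlo 0 (by simpa using hr)
  rw [hSg0] at hz0'
  refine slope_abstract (essNumRangeB T) (ess_isCompact T) hre z0 hz0
    (le_antisymm (by simpa using hz0') (hre z0 hz0)) Sg C r hr hC ?_ ?_
  · intro t h1 h2
    exact hup t (by rwa [abs_of_pos h1])
  · intro t h1 h2
    exact hlo t (by rwa [abs_of_pos h1])
end
end
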